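/- Let p be a prime, let C, K be natural numbers with 0 < C < p, let Γ : Fin C → Finset (Fin K) be the desired submodel index sets of the C clients, and let c ∈ ZMod p with c ≠ 0. For i : Fin C and k : Fin K define the incidence symbols Y i k ∈ ZMod p by Y i k = 1 if k ∈ Γ i and Y i k = 0 otherwise. Then for every k : Fin K, c · (∑_{i : Fin C} Y i k) ≠ 0 if and only if k ∈ Γ i for some i; equivalently, the set {k : Fin K | c · ∑_i Y i k ≠ 0} equals the union ⋃_{i} Γ i (as a Finset, Finset.univ.biUnion Γ). -/

import Mathlib

/-- A sum of fewer than `p` indicators in `ZMod p` is nonzero iff one of them is. -/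
theorem ZMod.sum_ite_one_zero_ne_zero_iff {ι : Type*} [Fintype ι] {p : ℕ}
    (hp : Fintype.card ι < p) (P : ι → Prop) [DecidablePred P] :
    (∑ i, if P i then (1 : ZMod p) else 0) ≠ 0 ↔ ∃ i, P i := by
  have hlt : (Finset.univ.filter P).card < p := (Finset.card_le_univ _).trans_lt hp
  rw [Finset.sum_boole, Ne, ZMod.natCast_eq_zero_iff]
  constructor
  · intro h
    by_contra! hP
    exact h (by simp [hP])
  · rintro ⟨i, hi⟩ hdvd
    exact Nat.not_dvd_of_pos_of_lt (Finset.card_pos.2 ⟨i, by simpa using hi⟩) hlt hdvd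

/-- FSL-PSU reliability: with `C < p` clients, incidence symbols `Y i k ∈ ZMod p`, and a
nonzero blinding symbol `c`, the coordinate `c * ∑ i, Y i k` is nonzero exactly when some
client desires submodel `k`; the set of such `k` is the union of the clients' index sets. -/
theorem fsl_psu_reliability {p : ℕ} [Fact p.Prime] {C K : ℕ} (hC : 0 < C) (hCp : C < p)
    (Γ : Fin C → Finset (Fin K)) (c : ZMod p) (hc : c ≠ 0)
    (Y : Fin C → Fin K → ZMod p)
    (hY : ∀ i k, Y i k = if k ∈ Γ i then 1 else 0) :
    (∀ k : Fin K, c * (∑ i, Y i k) ≠ 0 ↔ ∃ i, k ∈ Γ i)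
      ∧ Finset.univ.filter (fun k : Fin K => c * (∑ i, Y i k) ≠ 0)
          = Finset.univ.biUnion Γ := by
  have key : ∀ k : Fin K, c * (∑ i, Y i k) ≠ 0 ↔ ∃ i, k ∈ Γ i := by
    intro k
    simp only [hY]
    rw [mul_ne_zero_iff_left hc]
    exact ZMod.sum_ite_one_zero_ne_zero_iff (by simpa using hCp) (fun i => k ∈ Γ i)
  refine ⟨key, ?_⟩
  ext k
  simpa using key k
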